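/- Fix an integer r ≥ 1. There is a constant C > 0 such that for all sufficiently large N the following holds: set y = 1/(4√N); then for every real x with y ≤ |x| ≤ 1/2, writing τ = x + iy and q = e^{2πiτ}, one has |SC_r(q)| ≤ C·N^{r/2 + 1/4}·e^{π√N/4} and |SR_r(q)| ≤ C·N^{r/2 + 1/4}·e^{π√N/4}. -/

import Mathlib

open scoped BigOperators
open Filter MeasureTheory

/-- An overpartition of `n`: a partition of `n` in which the first occurrence of
each part size may be overlined.  We encode it as a finite set of (distinct)
overlined parts together with a multiset of non-overlined parts, all positive,
with total sum `n`. -/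
structure Overpartition (n : ℕ) where
  overlined : Finset ℕ
  nonoverlined : Multiset ℕ
  overlined_pos : ∀ i ∈ overlined, 0 < i
  nonoverlined_pos : ∀ i ∈ nonoverlined, 0 < i
  total : (overlined.sum id) + nonoverlined.sum = n

namespace Overpartition

/-- The multiset of all parts of an overpartition. -/
def parts {n : ℕ} (p : Overpartition n) : Multiset ℕ := p.overlined.val + p.nonoverlined

/-- Dyson's rank of an overpartition: largest part minus number of parts. -/
def rank {n : ℕ} (p : Overpartition n) : ℤ :=
  (p.parts.sup : ℤ) - (Multiset.card p.parts : ℤ)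

end Overpartition

/-- The crank of a partition (given as a multiset of positive parts):
the largest part if there are no 1's, and otherwise `μ(λ) - o(λ)` where `o(λ)`
is the number of 1's and `μ(λ)` is the number of parts larger than `o(λ)`. -/
def multisetCrank (s : Multiset ℕ) : ℤ :=
  if s.count 1 = 0 then (s.sup : ℤ)
  else ((s.filter (fun part => s.count 1 < part)).card : ℤ) - (s.count 1 : ℤ)

/-- The first residual crank of an overpartition: the crank of the subpartition
consisting of the non-overlined parts. -/
def Overpartition.crank {n : ℕ} (p : Overpartition n) : ℤ := multisetCrank p.nonoverlined

/-- `Mbar m n` is the number of overpartitions of `n` with first residual crank `m`. -/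
noncomputable def Mbar (m : ℤ) (n : ℕ) : ℕ :=
  Nat.card {p : Overpartition n // p.crank = m}

/-- `Nbar m n` is the number of overpartitions of `n` with Dyson rank `m`. -/
noncomputable def Nbar (m : ℤ) (n : ℕ) : ℕ :=
  Nat.card {p : Overpartition n // p.rank = m}

/-- The `r`-th positive crank moment `M̄_r^+(N) = Σ_{m ≥ 1} m^r M̄(m,N)`. -/
noncomputable def Mplus (r N : ℕ) : ℝ :=
  ∑' m : ℕ, ((m : ℝ) + 1) ^ r * (Mbar ((m : ℤ) + 1) N : ℝ)

/-- The `r`-th positive rank moment `N̄_r^+(N) = Σ_{m ≥ 1} m^r N̄(m,N)`. -/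
noncomputable def Nplus (r N : ℕ) : ℝ :=
  ∑' m : ℕ, ((m : ℝ) + 1) ^ r * (Nbar ((m : ℤ) + 1) N : ℝ)

/-- Positive symmetrized crank moment `μ̄_r^+(n) = Σ_{m ≥ 1} C(m + ⌊(r-1)/2⌋, r) M̄(m,n)`. -/
noncomputable def mubar (r n : ℕ) : ℝ :=
  ∑' m : ℕ, (Nat.choose (m + 1 + (r - 1) / 2) r : ℝ) * (Mbar ((m : ℤ) + 1) n : ℝ)

/-- Positive symmetrized rank moment `η̄_r^+(n) = Σ_{m ≥ 1} C(m + ⌊(r-1)/2⌋, r) N̄(m,n)`. -/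
noncomputable def etabar (r n : ℕ) : ℝ :=
  ∑' m : ℕ, (Nat.choose (m + 1 + (r - 1) / 2) r : ℝ) * (Nbar ((m : ℤ) + 1) n : ℝ)

/-- The Dirichlet eta function at positive integers:
`η(1) = log 2` and `η(r) = (1 - 2^{1-r}) ζ(r)` for `r ≥ 2`. -/
noncomputable def dirichletEtaNat (r : ℕ) : ℝ :=
  if r = 1 then Real.log 2 else (1 - 2 ^ (1 - (r : ℝ))) * (riemannZeta r).re

/-- The infinite Pochhammer symbol `(a; q)_∞ = Π_{j ≥ 0} (1 - a q^j)`. -/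
noncomputable def poch (a q : ℂ) : ℂ := ∏' j : ℕ, (1 - a * q ^ j)

/-- The (integral) exponent `n²/2 + (r/2 + ρ_C(r)) n`, where `ρ_C(r) = 0` for odd `r`
and `1/2` for even `r`. -/
def eC (r n : ℕ) : ℕ := (n * n + r * n + (if r % 2 = 0 then n else 0)) / 2

/-- The (integral) exponent `n² + (r/2 + ρ_R(r)) n`, where `ρ_R(r) = 1/2` for odd `r`
and `1` for even `r`. -/
def eR (r n : ℕ) : ℕ := (2 * n * n + r * n + (if r % 2 = 1 then n else 2 * n)) / 2

/-- `S_r(q) = Σ_{n ≥ 1} (-1)^{n+1} q^{n²/2 + (r/2 + ρ_C(r)) n} / (1 - q^n)^r`. -/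
noncomputable def Sr (r : ℕ) (q : ℂ) : ℂ :=
  ∑' n : ℕ, (-1 : ℂ) ^ n * q ^ eC r (n + 1) / (1 - q ^ (n + 1)) ^ r

/-- `S̃_r(q) = Σ_{n ≥ 1} (-1)^{n+1} q^{n² + (r/2 + ρ_R(r)) n} / ((1 - q^n)^r (1 + q^n))`. -/
noncomputable def Str (r : ℕ) (q : ℂ) : ℂ :=
  ∑' n : ℕ, (-1 : ℂ) ^ n * q ^ eR r (n + 1) / ((1 - q ^ (n + 1)) ^ r * (1 + q ^ (n + 1)))

/-- `SC_r(q) = ((-q;q)_∞/(q;q)_∞) S_r(q)`, the generating function of the positive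
symmetrized crank moments. -/
noncomputable def SCr (r : ℕ) (q : ℂ) : ℂ := (poch (-q) q / poch q q) * Sr r q

/-- `SR_r(q) = 2 ((-q;q)_∞/(q;q)_∞) S̃_r(q)`, the generating function of the positive
symmetrized rank moments. -/
noncomputable def SRr (r : ℕ) (q : ℂ) : ℂ := 2 * (poch (-q) q / poch q q) * Str r q

/-- `c_r = ζ(r) (1 - 2^{1-r})`. -/
noncomputable def cconst (r : ℕ) : ℂ := riemannZeta r * (1 - 2 ^ (1 - (r : ℂ)))

/-- `d_r = -(ζ(r-2)(1-2^{3-r})/2 + ρ_C(r) ζ(r-1)(1-2^{1-r}))`. -/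
noncomputable def dconst (r : ℕ) : ℂ :=
  -(riemannZeta ((r : ℂ) - 2) * (1 - 2 ^ (3 - (r : ℂ))) / 2 +
    (if r % 2 = 0 then (1 : ℂ) / 2 else 0) * riemannZeta ((r : ℂ) - 1) * (1 - 2 ^ (1 - (r : ℂ))))

/-- `d'_r = -(ζ(r-2)(1-2^{3-r}) + (ρ_R(r)/2) ζ(r-1)(1-2^{1-r}))`. -/
noncomputable def dconst' (r : ℕ) : ℂ :=
  -(riemannZeta ((r : ℂ) - 2) * (1 - 2 ^ (3 - (r : ℂ))) +
    (if r % 2 = 1 then (1 : ℂ) / 4 else (1 : ℂ) / 2) * riemannZeta ((r : ℂ) - 1) *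
      (1 - 2 ^ (1 - (r : ℂ))))

/-- The modified Bessel function of the first kind,
`I_s(x) = Σ_{k ≥ 0} (x/2)^{2k+s} / (k! Γ(k+s+1))`. -/
noncomputable def besselI (s x : ℝ) : ℝ :=
  ∑' k : ℕ, (x / 2) ^ (2 * (k : ℝ) + s) / ((k.factorial : ℝ) * Real.Gamma ((k : ℝ) + s + 1))

/-- The point `τ = x + i y` in the upper half plane. -/
noncomputable def mkTau (x y : ℝ) : ℂ := (x : ℂ) + (y : ℂ) * Complex.I

lemma aux_exp_lt_one {x : ℝ} (hx : x < 0) : Real.exp x < 1 := by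
  rw [← Real.exp_zero]
  exact Real.exp_lt_exp.2 hx

lemma aux_odd_log {u : ℂ} (hu : ‖u‖ < 1) :
    HasSum (fun k : ℕ => 2 / (2 * (k : ℂ) + 1) * u ^ (2 * k + 1))
      (Complex.log (1 + u) - Complex.log (1 - u)) := by
  have h := (Complex.hasSum_taylorSeries_log hu).add (Complex.hasSum_taylorSeries_neg_log hu)
  have hinj : Function.Injective (fun k : ℕ => 2 * k + 1) := by
    intro a b hab
    simp only at hab
    omega
  rw [← sub_eq_add_neg, ← hinj.hasSum_iff] at h
  · refine h.congr_fun ?_ |> fun h' => h'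
    intro k
    simp only [Function.comp]
    have : (-1 : ℂ) ^ (2 * k + 1 + 1) = 1 := by
      rw [show 2 * k + 1 + 1 = 2 * (k + 1) by ring, pow_mul]; simp
    rw [this]
    push_cast
    ring
  · intro n hn
    have : Even n := by
      by_contra hne
      rw [Nat.not_even_iff_odd] at hne
      obtain ⟨k, hk⟩ := hne
      exact hn ⟨k, hk.symm⟩
    rw [pow_succ, this.neg_one_pow]
    ring

lemma aux_summable_pow {ρ : ℝ} (h0 : 0 ≤ ρ) (h1 : ρ < 1) :
    Summable (fun p : ℕ × ℕ => 2 * (ρ ^ (p.1) * ρ ^ (p.2))) :=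
  ((summable_geometric_of_lt_one h0 h1).mul_of_nonneg (summable_geometric_of_lt_one h0 h1)
    (fun _ => pow_nonneg h0 _) (fun _ => pow_nonneg h0 _)).mul_left 2

lemma aux_poch1 {q : ℂ} (hq : ‖q‖ < 1) :
    ∃ A : ℂ, HasSum (fun j : ℕ => Complex.log (1 + q ^ (j + 1))) A ∧ poch (-q) q = Complex.exp A := by
  have hu : ∀ j : ℕ, ‖q ^ (j + 1)‖ < 1 := fun j => by
    rw [norm_pow]; exact pow_lt_one₀ (norm_nonneg _) hq (by omega)
  have hs : Summable (fun j : ℕ => q ^ (j + 1)) :=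
    (summable_nat_add_iff 1).2 (summable_geometric_of_norm_lt_one hq)
  have hA := (Complex.summable_log_one_add_of_summable hs).hasSum
  refine ⟨_, hA, ?_⟩
  rw [← hA.cexp.tprod_eq, poch]
  refine tprod_congr fun j => ?_
  have h0 : 1 + q ^ (j + 1) ≠ 0 := by
    intro h2
    have h3 : q ^ (j + 1) = -1 := by linear_combination h2
    have h4 := hu j
    rw [h3] at h4; simp at h4
  rw [Function.comp, Complex.exp_log h0]
  ring

lemma aux_poch2 {q : ℂ} (hq : ‖q‖ < 1) :
    ∃ A : ℂ, HasSum (fun j : ℕ => Complex.log (1 - q ^ (j + 1))) A ∧ poch q q = Complex.exp A := by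
  have hu : ∀ j : ℕ, ‖q ^ (j + 1)‖ < 1 := fun j => by
    rw [norm_pow]; exact pow_lt_one₀ (norm_nonneg _) hq (by omega)
  have hs : Summable (fun j : ℕ => q ^ (j + 1)) :=
    (summable_nat_add_iff 1).2 (summable_geometric_of_norm_lt_one hq)
  have hA := (Complex.summable_log_one_add_of_summable hs.neg).hasSum
  simp only [← sub_eq_add_neg] at hA
  refine ⟨_, hA, ?_⟩
  rw [← hA.cexp.tprod_eq, poch]
  refine tprod_congr fun j => ?_
  have h0 : 1 - q ^ (j + 1) ≠ 0 := by
    intro h2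
    have h3 : q ^ (j + 1) = 1 := by linear_combination -h2
    have h4 := hu j
    rw [h3] at h4; simp at h4
  rw [Function.comp, Complex.exp_log h0]
  ring

lemma aux_poch3 {q : ℂ} (hq : ‖q‖ < 1) :
    Summable (fun p : ℕ × ℕ => 2 / (2 * (p.2 : ℂ) + 1) * (q ^ (p.1 + 1)) ^ (2 * p.2 + 1)) := by
  refine Summable.of_norm_bounded (aux_summable_pow (norm_nonneg q) hq) ?_
  rintro ⟨j, k⟩
  simp only
  rw [norm_mul, norm_div, norm_pow, norm_pow, ← pow_mul, ← pow_add]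
  have e1 : ‖(2 * (k : ℂ) + 1)‖ = 2 * (k : ℝ) + 1 := by
    rw [show (2 * (k : ℂ) + 1) = ((2 * k + 1 : ℕ) : ℂ) by push_cast; ring, Complex.norm_natCast]
    push_cast; ring
  rw [e1]
  have e2 : ‖(2 : ℂ)‖ = 2 := by simp
  rw [e2]
  apply mul_le_mul
  · apply div_le_self (by norm_num)
    have : (0 : ℝ) ≤ k := by positivity
    linarith
  · apply pow_le_pow_of_le_one (norm_nonneg _) hq.le
    nlinarith [Nat.zero_le (j * k)]
  · positivity
  · norm_num

lemma aux_poch {q : ℂ} (hq : ‖q‖ < 1) :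
    ∃ L : ℂ, HasSum (fun k : ℕ => 2 / (2 * (k : ℂ) + 1) *
      (q ^ (2 * k + 1) / (1 - q ^ (2 * k + 1)))) L ∧
      poch (-q) q / poch q q = Complex.exp L := by
  have hu : ∀ j : ℕ, ‖q ^ (j + 1)‖ < 1 := fun j => by
    rw [norm_pow]; exact pow_lt_one₀ (norm_nonneg _) hq (by omega)
  obtain ⟨A, hA, hPA⟩ := aux_poch1 hq
  obtain ⟨B, hB, hPB⟩ := aux_poch2 hq
  have hL := (aux_poch3 hq).hasSum
  generalize (∑' p : ℕ × ℕ, 2 / (2 * (p.2 : ℂ) + 1) * (q ^ (p.1 + 1)) ^ (2 * p.2 + 1)) = L at hL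
  have h0 : ∀ j : ℕ, HasSum (fun k : ℕ => (fun p : ℕ × ℕ => 2 / (2 * (p.2 : ℂ) + 1) *
      (q ^ (p.1 + 1)) ^ (2 * p.2 + 1)) (j, k))
      (Complex.log (1 + q ^ (j + 1)) - Complex.log (1 - q ^ (j + 1))) := by
    intro j
    simp only
    exact aux_odd_log (hu j)
  have h1 := HasSum.prod_fiberwise hL h0
  have hLAB : L = A - B := h1.unique (hA.sub hB)
  have hL' : HasSum ((fun p : ℕ × ℕ => 2 / (2 * (p.2 : ℂ) + 1) * (q ^ (p.1 + 1)) ^ (2 * p.2 + 1)) ∘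
      (Equiv.prodComm ℕ ℕ)) L :=
    (Equiv.prodComm ℕ ℕ).hasSum_iff.2 hL
  have h2 : ∀ k : ℕ, HasSum (fun j : ℕ => ((fun p : ℕ × ℕ => 2 / (2 * (p.2 : ℂ) + 1) *
      (q ^ (p.1 + 1)) ^ (2 * p.2 + 1)) ∘ (Equiv.prodComm ℕ ℕ)) (k, j))
      (2 / (2 * (k : ℂ) + 1) * (q ^ (2 * k + 1) / (1 - q ^ (2 * k + 1)))) := by
    intro k
    have e : (fun j : ℕ => ((fun p : ℕ × ℕ => 2 / (2 * (p.2 : ℂ) + 1) *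
      (q ^ (p.1 + 1)) ^ (2 * p.2 + 1)) ∘ (Equiv.prodComm ℕ ℕ)) (k, j)) =
      (fun j : ℕ => 2 / (2 * (k : ℂ) + 1) * (q ^ (2 * k + 1) * (q ^ (2 * k + 1)) ^ j)) := by
      funext j
      simp only [Function.comp, Equiv.prodComm_apply, Prod.swap]
      rw [← pow_succ', ← pow_mul, ← pow_mul, mul_comm (j + 1)]
    rw [e, div_eq_mul_inv (q ^ (2 * k + 1))]
    exact ((hasSum_geometric_of_norm_lt_one (hu (2 * k))).mul_left _).mul_left _
  refine ⟨L, hL'.prod_fiberwise h2, ?_⟩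
  rw [hPA, hPB, hLAB, Complex.exp_sub]

lemma aux_odd_sq : HasSum (fun k : ℕ => 1 / (2 * (k : ℝ) + 1) ^ 2) (Real.pi ^ 2 / 8) := by
  have h := hasSum_zeta_two
  have he : HasSum (fun k : ℕ => 1 / ((2 * k : ℕ) : ℝ) ^ 2) (Real.pi ^ 2 / 24) := by
    have := h.mul_left (1 / 4)
    rw [show Real.pi ^ 2 / 24 = 1 / 4 * (Real.pi ^ 2 / 6) by ring]
    refine this.congr_fun ?_ |> fun h' => h'
    intro k
    push_cast
    ring
  have ho : Summable (fun k : ℕ => 1 / ((2 * k + 1 : ℕ) : ℝ) ^ 2) :=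
    h.summable.comp_injective (i := fun k : ℕ => 2 * k + 1) (by
      intro a b hab
      simp only at hab
      omega)
  obtain ⟨s, hs⟩ := ho
  have := (he.even_add_odd (f := fun n : ℕ => 1 / (n : ℝ) ^ 2) hs).unique h
  have hs' : s = Real.pi ^ 2 / 8 := by linarith
  rw [hs'] at hs
  refine hs.congr_fun ?_ |> fun h' => h'
  intro k
  push_cast
  ring

/-- telescoping sum -/
lemma aux_tele {t : ℝ} (ht : 0 < t) :
    ∃ D : ℝ, D ≤ 1 ∧ HasSum (fun k : ℕ => t / (1 + (2 * (k : ℝ) + 1) * t) ^ 2) D := by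
  have hnn : ∀ k : ℕ, 0 ≤ t / (1 + (2 * (k : ℝ) + 1) * t) ^ 2 := fun k => by positivity
  have hb : ∀ n : ℕ, ∑ k ∈ Finset.range n, t / (1 + (2 * (k : ℝ) + 1) * t) ^ 2 ≤ 1 := by
    intro n
    have : ∑ k ∈ Finset.range n, t / (1 + (2 * (k : ℝ) + 1) * t) ^ 2 ≤ 1 - 1 / (1 + n * t) := by
      induction n with
      | zero => simp
      | succ n ih =>
        rw [Finset.sum_range_succ]
        have hn : (0 : ℝ) ≤ n := by positivity
        have : t / (1 + (2 * (n : ℝ) + 1) * t) ^ 2 ≤ 1 / (1 + n * t) - 1 / (1 + (n + 1) * t) := by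
          rw [div_sub_div _ _ (by positivity) (by positivity)]
          rw [show 1 * (1 + ((n : ℝ) + 1) * t) - (1 + n * t) * 1 = t by ring]
          apply div_le_div_of_nonneg_left ht.le (by positivity)
          have : 0 ≤ n * t := by positivity
          rw [sq]
          apply mul_le_mul <;> nlinarith
        push_cast
        linarith
    have h2 : 0 ≤ 1 / (1 + n * t) := by positivity
    linarith
  exact ⟨_, Real.tsum_le_of_sum_range_le hnn hb, (summable_of_sum_range_le hnn hb).hasSum⟩

/-- cone bound -/
lemma aux_cone {w : ℂ} (hw : 0 < w.re) (hc : |w.im| ≤ 10 * w.re) :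
    ‖1 / (Complex.exp w - 1) - 1 / w + (Real.exp (-w.re) : ℂ) / 2‖ ≤ 84 * ‖w‖ / (1 + ‖w‖) ^ 2 := by
  have hn : ‖w‖ ≤ 11 * w.re := by
    have := Complex.norm_le_abs_re_add_abs_im w
    rw [abs_of_pos hw] at this
    linarith
  have hre : w.re ≤ ‖w‖ := Complex.re_le_norm w
  have hpos : 0 < ‖w‖ := by linarith
  have hE : w.re ≤ ‖Complex.exp w - 1‖ := by
    have h1 := norm_sub_norm_le (Complex.exp w) 1
    rw [Complex.norm_exp, norm_one] at h1
    have := Real.add_one_le_exp w.re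
    linarith
  have hw0 : w ≠ 0 := norm_pos_iff.1 hpos
  have hEpos : 0 < ‖Complex.exp w - 1‖ := by linarith
  have hE0 : Complex.exp w - 1 ≠ 0 := norm_pos_iff.1 hEpos
  have hEn : ‖w‖ / 11 ≤ ‖Complex.exp w - 1‖ := by linarith
  have hexp : ‖((Real.exp (-w.re) : ℝ) : ℂ)‖ = Real.exp (-w.re) := by
    rw [Complex.norm_real, Real.norm_eq_abs, abs_of_pos (Real.exp_pos _)]
  rcases le_total ‖w‖ 1 with h1 | h1
  · have hb := Complex.exp_bound h1 (n := 3) (by norm_num)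
    simp only [Finset.sum_range_succ, Finset.sum_range_zero] at hb
    norm_num [Nat.factorial] at hb
    set R := Complex.exp w - (1 + w + w ^ 2 / 2) with hR
    have hRb : ‖R‖ ≤ ‖w‖ ^ 3 := by
      have : 0 ≤ ‖w‖ ^ 3 := by positivity
      linarith
    have hEe : Complex.exp w - 1 = w + w ^ 2 / 2 + R := by rw [hR]; ring
    have key : 1 / (Complex.exp w - 1) - 1 / w + (Real.exp (-w.re) : ℂ) / 2 =
        (w ^ 3 / 2 - 2 * R + w * R) / (2 * w * (Complex.exp w - 1)) - (1 - (Real.exp (-w.re) : ℂ)) / 2 := by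
      field_simp
      rw [hEe]
      ring
    have hnum : ‖w ^ 3 / 2 - 2 * R + w * R‖ ≤ 7 / 2 * ‖w‖ ^ 3 := by
      calc _ ≤ ‖w ^ 3 / 2‖ + ‖2 * R‖ + ‖w * R‖ := by
            refine (norm_add_le _ _).trans ?_
            gcongr
            exact norm_sub_le _ _
        _ = ‖w‖ ^ 3 / 2 + 2 * ‖R‖ + ‖w‖ * ‖R‖ := by simp
        _ ≤ ‖w‖ ^ 3 / 2 + 2 * ‖w‖ ^ 3 + 1 * ‖w‖ ^ 3 := by gcongr
        _ = _ := by ring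
    have h2 : ‖(w ^ 3 / 2 - 2 * R + w * R) / (2 * w * (Complex.exp w - 1))‖ ≤ 20 * ‖w‖ := by
      rw [norm_div, norm_mul, norm_mul]
      rw [div_le_iff₀ (mul_pos (mul_pos (by norm_num) hpos) hEpos)]
      have e2 : ‖(2 : ℂ)‖ = 2 := by simp
      rw [e2]
      calc _ ≤ 7 / 2 * ‖w‖ ^ 3 := hnum
        _ ≤ 20 * ‖w‖ * (2 * ‖w‖ * (‖w‖ / 11)) := by
          have : 0 ≤ ‖w‖ ^ 3 := by positivity
          nlinarith
        _ ≤ _ := by gcongr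
    have h3 : ‖(1 - (Real.exp (-w.re) : ℂ)) / 2‖ ≤ ‖w‖ := by
      rw [norm_div]
      have : (1 - ((Real.exp (-w.re) : ℝ) : ℂ)) = ((1 - Real.exp (-w.re) : ℝ) : ℂ) := by push_cast; ring
      rw [this, Complex.norm_real, Real.norm_eq_abs]
      have a1 := Real.add_one_le_exp (-w.re)
      have a2 : Real.exp (-w.re) ≤ 1 := Real.exp_le_one_iff.2 (by linarith)
      rw [abs_of_nonneg (by linarith)]
      have e2 : ‖(2 : ℂ)‖ = 2 := by simp
      rw [e2]
      linarith
    rw [key]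
    refine (norm_sub_le _ _).trans ?_
    rw [le_div_iff₀ (by positivity)]
    have : (1 + ‖w‖) ^ 2 ≤ 4 := by nlinarith
    calc _ ≤ (21 * ‖w‖) * 4 := by
          gcongr
          linarith
      _ = _ := by ring
  · have b1 : ‖1 / (Complex.exp w - 1)‖ ≤ 11 / ‖w‖ := by
      rw [norm_div, norm_one, div_le_div_iff₀ hEpos hpos]
      linarith
    have b2 : ‖1 / w‖ = 1 / ‖w‖ := by simp
    have b3 : ‖((Real.exp (-w.re) : ℝ) : ℂ) / 2‖ ≤ 9 / ‖w‖ := by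
      rw [norm_div, hexp, Real.exp_neg]
      have e2 : ‖(2 : ℂ)‖ = 2 := by simp
      rw [e2, div_le_div_iff₀ (by norm_num) hpos, ← div_eq_inv_mul, div_le_iff₀ (Real.exp_pos _)]
      have := Real.add_one_le_exp w.re
      linarith
    calc _ ≤ ‖1 / (Complex.exp w - 1)‖ + ‖1 / w‖ + ‖((Real.exp (-w.re) : ℝ) : ℂ) / 2‖ := by
          refine (norm_add_le _ _).trans ?_
          gcongr
          exact norm_sub_le _ _
      _ ≤ 11 / ‖w‖ + 1 / ‖w‖ + 9 / ‖w‖ := by rw [b2]; gcongr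
      _ = 21 / ‖w‖ := by ring
      _ ≤ _ := by
        rw [div_le_div_iff₀ hpos (by positivity)]
        have : (1 + ‖w‖) ^ 2 ≤ 4 * ‖w‖ ^ 2 := by nlinarith
        nlinarith

lemma aux_term {z : ℂ} (hz : 0 < z.re) (k : ℕ) :
    Complex.exp (-z) ^ (2 * k + 1) / (1 - Complex.exp (-z) ^ (2 * k + 1)) =
      1 / (Complex.exp ((2 * (k : ℂ) + 1) * z) - 1) := by
  have h1 : Complex.exp (-z) ^ (2 * k + 1) = (Complex.exp ((2 * (k : ℂ) + 1) * z))⁻¹ := by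
    rw [← Complex.exp_nat_mul, ← Complex.exp_neg]
    congr 1
    push_cast
    ring
  have h0 := Complex.exp_ne_zero ((2 * (k : ℂ) + 1) * z)
  rw [h1]
  set E := Complex.exp ((2 * (k : ℂ) + 1) * z)
  rw [show (1 - E⁻¹) = (E - 1) / E by field_simp, inv_eq_one_div, div_div_div_cancel_right₀ h0]

lemma aux_re_mul (c : ℝ) (w : ℂ) : ((c : ℂ) * w).re = c * w.re := by simp

lemma aux_P1 {z L : ℂ} (hz : 0 < z.re) (h1 : z.re ≤ |z.im|) (h2 : |z.im| ≤ 10 * z.re)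
    (hL : HasSum (fun k : ℕ => 2 / (2 * (k : ℂ) + 1) *
      (Complex.exp (-z) ^ (2 * k + 1) / (1 - Complex.exp (-z) ^ (2 * k + 1)))) L) :
    L.re ≤ Real.pi ^ 2 / (8 * z.re) + Real.log z.re / 2 + 168 := by
  have hre := Complex.hasSum_re hL
  have ht : 0 < ‖z‖ := lt_of_lt_of_le hz (Complex.re_le_norm z)
  obtain ⟨D, hD1, hD⟩ := aux_tele ht
  have hx : |Real.exp (-z.re)| < 1 := by
    rw [abs_of_pos (Real.exp_pos _)]
    exact (aux_exp_lt_one (by linarith))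
  have hlog := Real.hasSum_log_sub_log_of_abs_lt_one hx
  have hsum := ((aux_odd_sq.mul_left (2 * (1 / z).re)).sub (hlog.mul_left (1 / 2))).add
    (hD.mul_left 168)
  have hle := hasSum_le (fun k => ?_) hre hsum
  · have hinv : (1 / z).re ≤ 1 / (2 * z.re) := by
      rw [one_div, Complex.inv_re, Complex.normSq_apply, div_le_div_iff₀ (by nlinarith [mul_self_nonneg z.im]) (by positivity)]
      have : z.re * z.re ≤ z.im * z.im := by
        rw [← abs_mul_abs_self z.im]
        exact mul_self_le_mul_self hz.le h1
      nlinarith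
    have e1 : 2 * (1 / z).re * (Real.pi ^ 2 / 8) ≤ Real.pi ^ 2 / (8 * z.re) := by
      calc _ ≤ 2 * (1 / (2 * z.re)) * (Real.pi ^ 2 / 8) := by gcongr
        _ = _ := by field_simp
    have e2 : 0 ≤ Real.log (1 + Real.exp (-z.re)) :=
      Real.log_nonneg (by have := Real.exp_pos (-z.re); linarith)
    have e3 : Real.log (1 - Real.exp (-z.re)) ≤ Real.log z.re := by
      apply Real.log_le_log
      · rw [abs_of_pos (Real.exp_pos _)] at hx
        linarith
      · have := Real.add_one_le_exp (-z.re)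
        linarith
    linarith
  · have hm : (0 : ℝ) < 2 * (k : ℝ) + 1 := by positivity
    set m : ℝ := 2 * (k : ℝ) + 1 with hmdef
    have hmc : (2 * (k : ℂ) + 1) = (m : ℂ) := by rw [hmdef]; push_cast; ring
    rw [aux_term hz, hmc, show (2 : ℂ) / (m : ℂ) = ((2 / m : ℝ) : ℂ) by push_cast; ring, aux_re_mul]
    have hw1 : ((m : ℂ) * z).re = m * z.re := aux_re_mul m z
    have hw2 : ((m : ℂ) * z).im = m * z.im := by simp
    have hw3 : ‖(m : ℂ) * z‖ = m * ‖z‖ := by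
      rw [norm_mul, Complex.norm_real, Real.norm_eq_abs, abs_of_pos hm]
    have hc := aux_cone (w := (m : ℂ) * z) (by rw [hw1]; positivity) (by
      rw [hw1, hw2, abs_mul, abs_of_pos hm]
      nlinarith)
    have hc' := (Complex.re_le_norm _).trans hc
    rw [hw3, hw1] at hc'
    have hinv : (1 / ((m : ℂ) * z)).re = (1 / z).re / m := by
      rw [show 1 / ((m : ℂ) * z) = ((1 / m : ℝ) : ℂ) * (1 / z) by push_cast; field_simp, aux_re_mul]
      ring
    have hex : (((Real.exp (-(m * z.re)) : ℝ) : ℂ) / 2).re = Real.exp (-(m * z.re)) / 2 := by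
      rw [show ((Real.exp (-(m * z.re)) : ℝ) : ℂ) / 2 = ((Real.exp (-(m * z.re)) / 2 : ℝ) : ℂ) by
        push_cast; ring, Complex.ofReal_re]
    rw [Complex.add_re, Complex.sub_re, hinv, hex] at hc'
    have hpow : Real.exp (-z.re) ^ (2 * k + 1) = Real.exp (-(m * z.re)) := by
      rw [← Real.exp_nat_mul]
      congr 1
      rw [hmdef]
      push_cast
      ring
    rw [hpow]
    have h3 : (1 / (Complex.exp ((m : ℂ) * z) - 1)).re ≤ (1 / z).re / m - Real.exp (-(m * z.re)) / 2 +
        84 * (m * ‖z‖) / (1 + m * ‖z‖) ^ 2 := by linarith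
    calc 2 / m * (1 / (Complex.exp ((m : ℂ) * z) - 1)).re
        ≤ 2 / m * ((1 / z).re / m - Real.exp (-(m * z.re)) / 2 +
        84 * (m * ‖z‖) / (1 + m * ‖z‖) ^ 2) := by gcongr
      _ = _ := by
        field_simp
        ring

lemma aux_norm_inv {w : ℂ} (hw : 0 < w.re) : ‖1 / (Complex.exp w - 1)‖ ≤ 1 / w.re := by
  have hE : w.re ≤ ‖Complex.exp w - 1‖ := by
    have h1 := norm_sub_norm_le (Complex.exp w) 1
    rw [Complex.norm_exp, norm_one] at h1
    have := Real.add_one_le_exp w.re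
    linarith
  rw [norm_div, norm_one]
  exact one_div_le_one_div_of_le hw hE

lemma aux_norm_inv2 {w : ℂ} (hw : 0 < w.re) (h2 : 10 * w.re ≤ |w.im|) (h3 : |w.im| ≤ Real.pi) :
    ‖1 / (Complex.exp w - 1)‖ ≤ 1 / (6 * w.re) := by
  have hE : 6 * w.re ≤ ‖Complex.exp w - 1‖ := by
    refine (sq_le_sq₀ (by positivity) (norm_nonneg _)).1 ?_
    rw [← Complex.normSq_eq_norm_sq, Complex.normSq_apply]
    simp only [Complex.sub_re, Complex.sub_im, Complex.one_re, Complex.one_im, Complex.exp_re,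
      Complex.exp_im]
    have hcos := Real.cos_le_one_sub_mul_cos_sq h3
    have hsc := Real.sin_sq_add_cos_sq w.im
    have he : 1 ≤ Real.exp w.re := Real.one_le_exp hw.le
    have hsq : (10 * w.re) ^ 2 ≤ w.im ^ 2 := by
      rw [← sq_abs w.im]
      gcongr
    have hpi : Real.pi ^ 2 ≤ 10 := by
      have := Real.pi_lt_d2
      have := Real.pi_pos
      nlinarith
    have hpi' : (1 : ℝ) / 5 ≤ 2 / Real.pi ^ 2 := by
      rw [div_le_div_iff₀ (by norm_num) (by positivity)]
      linarith
    have h5 : 20 * w.re ^ 2 ≤ 1 - Real.cos w.im := by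
      have : 1 / 5 * w.im ^ 2 ≤ 2 / Real.pi ^ 2 * w.im ^ 2 := by gcongr
      nlinarith
    have h6 : 0 ≤ 1 - Real.cos w.im := by have := Real.cos_le_one w.im; linarith
    have h7 : (1 - Real.cos w.im) ≤ Real.exp w.re * (1 - Real.cos w.im) := by nlinarith
    nlinarith [sq_nonneg (Real.exp w.re - 1), sq_nonneg w.re]
  rw [norm_div, norm_one]
  exact one_div_le_one_div_of_le (by positivity) hE

lemma aux_P2 {z L : ℂ} (hz : 0 < z.re) (h2 : 10 * z.re ≤ |z.im|) (h3 : |z.im| ≤ Real.pi)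
    (hL : HasSum (fun k : ℕ => 2 / (2 * (k : ℂ) + 1) *
      (Complex.exp (-z) ^ (2 * k + 1) / (1 - Complex.exp (-z) ^ (2 * k + 1)))) L) :
    L.re ≤ Real.pi ^ 2 / (8 * z.re) - 1 / (3 * z.re) := by
  have hre := Complex.hasSum_re hL
  have hsum := (aux_odd_sq.mul_left (2 / z.re)).add
    (hasSum_ite_eq (0 : ℕ) (-(5 / (3 * z.re))))
  have hle := hasSum_le (fun k => ?_) hre hsum
  · refine hle.trans ?_
    have hpi : Real.pi ^ 2 ≤ 10 := by
      have := Real.pi_lt_d2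
      have := Real.pi_pos
      nlinarith
    have : 2 / z.re * (Real.pi ^ 2 / 8) + -(5 / (3 * z.re)) =
       Real.pi ^ 2 / (8 * z.re) - 1 / (3 * z.re) + (Real.pi ^ 2 / 8 - 4 / 3) / z.re := by
      field_simp
      ring
    rw [this]
    have : (Real.pi ^ 2 / 8 - 4 / 3) / z.re ≤ 0 := div_nonpos_of_nonpos_of_nonneg (by linarith) hz.le
    linarith
  · have hm : (0 : ℝ) < 2 * (k : ℝ) + 1 := by positivity
    rw [aux_term hz]
    by_cases hk : k = 0
    · subst hk
      have := (Complex.re_le_norm _).trans (aux_norm_inv2 hz h2 h3)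
      simp only [Nat.cast_zero, mul_zero, zero_add, one_mul, div_one, if_true]
      rw [show (2 : ℂ) = ((2 : ℝ) : ℂ) by norm_num, aux_re_mul]
      calc _ ≤ 2 * (1 / (6 * z.re)) := by gcongr
        _ = _ := by field_simp; norm_num
    · set m : ℝ := 2 * (k : ℝ) + 1 with hmdef
      have hmc : (2 * (k : ℂ) + 1) = (m : ℂ) := by rw [hmdef]; push_cast; ring
      rw [hmc, show (2 : ℂ) / (m : ℂ) = ((2 / m : ℝ) : ℂ) by push_cast; ring, aux_re_mul, if_neg hk]
      have hw1 : ((m : ℂ) * z).re = m * z.re := aux_re_mul m z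
      have := (Complex.re_le_norm _).trans (aux_norm_inv (w := (m : ℂ) * z) (by rw [hw1]; positivity))
      rw [hw1] at this
      calc _ ≤ 2 / m * (1 / (m * z.re)) := by gcongr
        _ = _ := by field_simp; norm_num

lemma aux_P {z : ℂ} (hz : 0 < z.re) (h1 : z.re ≤ |z.im|) (h3 : |z.im| ≤ Real.pi) :
    ‖poch (-Complex.exp (-z)) (Complex.exp (-z)) / poch (Complex.exp (-z)) (Complex.exp (-z))‖ ≤
      Real.exp 168 * Real.sqrt z.re * Real.exp (Real.pi ^ 2 / (8 * z.re)) := by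
  have hq : ‖Complex.exp (-z)‖ < 1 := by
    rw [Complex.norm_exp, Complex.neg_re]
    exact (aux_exp_lt_one (by linarith))
  obtain ⟨L, hL, hP⟩ := aux_poch hq
  rw [hP, Complex.norm_exp]
  have hsq : Real.sqrt z.re = Real.exp (Real.log z.re / 2) := by
    rw [Real.exp_half, Real.exp_log hz]
  rcases le_total |z.im| (10 * z.re) with h2 | h2
  · rw [hsq, ← Real.exp_add, ← Real.exp_add]
    apply Real.exp_le_exp.2
    have := aux_P1 hz h1 h2 hL
    linarith
  · have := aux_P2 hz h2 h3 hL
    rw [hsq, ← Real.exp_add, ← Real.exp_add]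
    apply Real.exp_le_exp.2
    have hlog : -(1 / (3 * z.re)) ≤ 168 + Real.log z.re / 2 := by
      have := Real.log_le_sub_one_of_pos (inv_pos.2 (show 0 < 3 * z.re by positivity))
      rw [Real.log_inv, Real.log_mul (by norm_num) hz.ne'] at this
      have l3 := Real.log_le_sub_one_of_pos (show (0 : ℝ) < 3 by norm_num)
      rw [one_div]
      have : 0 < (3 * z.re)⁻¹ := by positivity
      linarith
    linarith

lemma aux_eC (r n : ℕ) (hn : 1 ≤ n) : (r + 1) * n ≤ 2 * eC r n := by
  unfold eC
  split_ifs with h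
  · have h1 : 2 ∣ n * n + r * n + n := by
      have : Even r := Nat.even_iff.2 h
      have h2 : Even (n * (n + 1)) := Nat.even_mul_succ_self n
      have h3 : Even (n * (n + 1) + r * n) := h2.add (this.mul_right n)
      rw [← even_iff_two_dvd, show n * n + r * n + n = n * (n + 1) + r * n by ring]
      exact h3
    rw [Nat.mul_div_cancel' h1]
    nlinarith
  · have h1 : 2 ∣ n * n + r * n + 0 := by
      have : Odd r := Nat.odd_iff.2 (by omega)
      obtain ⟨s, hs⟩ := this
      have h2 : Even (n * (n + 1)) := Nat.even_mul_succ_self n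
      have h3 : Even (n * (n + 1) + 2 * (s * n)) := h2.add (even_two_mul _)
      rw [← even_iff_two_dvd, show n * n + r * n + 0 = n * (n + 1) + 2 * (s * n) by rw [hs]; ring]
      exact h3
    rw [Nat.mul_div_cancel' h1]
    nlinarith

lemma aux_eR (r n : ℕ) (hn : 1 ≤ n) : (r + 1) * n ≤ 2 * eR r n := by
  unfold eR
  have h1 : 1 ≤ n * n := Nat.mul_pos hn hn
  have h2 : 2 * n * n = 2 * (n * n) := by ring
  have h3 : (r + 1) * n = r * n + n := by ring
  rw [h2, h3]
  split_ifs <;> omega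

lemma aux_basic {t : ℝ} (ht : 0 < t) : Real.exp (-t) / (1 - Real.exp (-t) ^ 2) ≤ 1 / (2 * t) := by
  have h := Real.self_le_sinh_iff.2 ht.le
  rw [Real.sinh_eq] at h
  have hlt : Real.exp (-t) < 1 := (aux_exp_lt_one (by linarith))
  have h0 := Real.exp_pos (-t)
  have hm : Real.exp t * Real.exp (-t) = 1 := by rw [← Real.exp_add]; simp
  rw [div_le_div_iff₀ (by nlinarith) (by positivity)]
  nlinarith

lemma aux_termS {a : ℝ} (ha : 0 < a) {r n e : ℕ} (hn : 1 ≤ n) (he : (r + 1) * n ≤ 2 * e) :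
    Real.exp (-a) ^ e / (1 - Real.exp (-a) ^ n) ^ (r + 1) ≤ (1 / (a * n)) ^ (r + 1) := by
  have hn' : (1 : ℝ) ≤ n := by exact_mod_cast hn
  have ht : 0 < a * n / 2 := by positivity
  have hb := aux_basic ht
  rw [show 2 * (a * n / 2) = a * n by ring] at hb
  have e1 : Real.exp (-(a * n / 2)) ^ 2 = Real.exp (-a) ^ n := by
    rw [← Real.exp_nat_mul, ← Real.exp_nat_mul]; congr 1; push_cast; ring
  rw [e1] at hb
  have hpos : 0 < 1 - Real.exp (-a) ^ n := by
    have : Real.exp (-a) ^ n < 1 :=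
      pow_lt_one₀ (Real.exp_pos _).le ((aux_exp_lt_one (by linarith))) (by omega)
    linarith
  have e2 : Real.exp (-a) ^ e ≤ Real.exp (-(a * n / 2)) ^ (r + 1) := by
    rw [← Real.exp_nat_mul, ← Real.exp_nat_mul]
    apply Real.exp_le_exp.2
    have : ((r : ℝ) + 1) * n ≤ 2 * e := by exact_mod_cast he
    push_cast
    nlinarith
  calc _ ≤ Real.exp (-(a * n / 2)) ^ (r + 1) / (1 - Real.exp (-a) ^ n) ^ (r + 1) := by gcongr
    _ = (Real.exp (-(a * n / 2)) / (1 - Real.exp (-a) ^ n)) ^ (r + 1) := by rw [div_pow]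
    _ ≤ _ := by gcongr

lemma aux_sumS {a : ℝ} (ha : 0 < a) {r : ℕ} (hr : 1 ≤ r) {f : ℕ → ℂ}
    (hf : ∀ n, ‖f n‖ ≤ (1 / (a * ((n + 1 : ℕ) : ℝ))) ^ (r + 1)) :
    ‖∑' n, f n‖ ≤ 2 * (1 / a) ^ (r + 1) := by
  have h0 : HasSum (fun n : ℕ => (1 : ℝ) / ((n + 1 : ℕ) : ℝ) ^ 2) (Real.pi ^ 2 / 6) := by
    have := (hasSum_nat_add_iff' 1).2 hasSum_zeta_two
    simpa using this
  have h := tsum_of_norm_bounded (f := f) (h0.mul_left ((1 / a) ^ (r + 1))) (fun n => ?_)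
  · have hpi : Real.pi ^ 2 / 6 ≤ 2 := by
      have := Real.pi_lt_d2
      have := Real.pi_pos
      nlinarith
    refine h.trans ?_
    rw [mul_comm]
    gcongr
  · refine (hf n).trans ?_
    rw [show 1 / (a * ((n + 1 : ℕ) : ℝ)) = 1 / a * (1 / ((n + 1 : ℕ) : ℝ)) by
      rw [one_div_mul_one_div], mul_pow, one_div_pow (((n + 1 : ℕ) : ℝ))]
    gcongr
    · have : 0 ≤ (n : ℝ) := by positivity
      push_cast
      linarith
    · omega

lemma aux_one_sub {ρ : ℝ} {u : ℂ} (hu : ‖u‖ = ρ) : 1 - ρ ≤ ‖1 - u‖ := by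
  have := norm_sub_norm_le (1 : ℂ) u
  rw [norm_one, hu] at this
  exact this

lemma aux_Sr {a : ℝ} (ha : 0 < a) {r : ℕ} (hr : 1 ≤ r) {q : ℂ} (hq : ‖q‖ = Real.exp (-a)) :
    ‖Sr r q‖ ≤ 2 * (1 / a) ^ (r + 1) ∧ ‖Str r q‖ ≤ 2 * (1 / a) ^ (r + 1) := by
  have hpos : ∀ n : ℕ, 0 < 1 - Real.exp (-a) ^ (n + 1) := fun n => by
    have : Real.exp (-a) ^ (n + 1) < 1 :=
      pow_lt_one₀ (Real.exp_pos _).le ((aux_exp_lt_one (by linarith))) (by omega)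
    linarith
  have hle1 : ∀ n : ℕ, 1 - Real.exp (-a) ^ (n + 1) ≤ 1 := fun n => by
    have : 0 ≤ Real.exp (-a) ^ (n + 1) := by positivity
    linarith
  constructor
  · refine aux_sumS ha hr (fun n => ?_)
    refine le_trans ?_ (aux_termS ha (by omega) (aux_eC r (n + 1) (by omega)))
    rw [norm_div, norm_mul, norm_pow, norm_pow, norm_pow, norm_neg, norm_one, one_pow, one_mul, hq]
    have h1 := aux_one_sub (u := q ^ (n + 1)) (ρ := Real.exp (-a) ^ (n + 1)) (by rw [norm_pow, hq])
    have hp := hpos n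
    apply div_le_div_of_nonneg_left (by positivity) (by positivity)
    calc _ ≤ (1 - Real.exp (-a) ^ (n + 1)) ^ r := pow_le_pow_of_le_one hp.le (hle1 n) (by omega)
      _ ≤ _ := by gcongr
  · refine aux_sumS ha hr (fun n => ?_)
    refine le_trans ?_ (aux_termS ha (by omega) (aux_eR r (n + 1) (by omega)))
    rw [norm_div, norm_mul, norm_mul, norm_pow, norm_pow, norm_pow, norm_neg, norm_one, one_pow,
      one_mul, hq]
    have h1 := aux_one_sub (u := q ^ (n + 1)) (ρ := Real.exp (-a) ^ (n + 1)) (by rw [norm_pow, hq])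
    have h2 := aux_one_sub (u := -q ^ (n + 1)) (ρ := Real.exp (-a) ^ (n + 1))
      (by rw [norm_neg, norm_pow, hq])
    rw [sub_neg_eq_add] at h2
    have hp := hpos n
    apply div_le_div_of_nonneg_left (by positivity) (by positivity)
    rw [pow_succ]
    gcongr

/-- Bounds for `SC_r` and `SR_r` away from the dominant pole. -/
theorem SCr_SRr_away_from_pole (r : ℕ) (hr : 1 ≤ r) :
    ∃ C : ℝ, 0 < C ∧ ∃ N₀ : ℕ, ∀ N : ℕ, N₀ ≤ N →
      ∀ x : ℝ, 1 / (4 * Real.sqrt N) ≤ |x| → |x| ≤ 1 / 2 →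
        ‖SCr r (Complex.exp (2 * Real.pi * Complex.I * mkTau x (1 / (4 * Real.sqrt N))))‖ ≤
            C * (N : ℝ) ^ ((r : ℝ) / 2 + 1 / 4) * Real.exp (Real.pi * Real.sqrt N / 4) ∧
          ‖SRr r (Complex.exp (2 * Real.pi * Complex.I * mkTau x (1 / (4 * Real.sqrt N))))‖ ≤
            C * (N : ℝ) ^ ((r : ℝ) / 2 + 1 / 4) * Real.exp (Real.pi * Real.sqrt N / 4) := by
  refine ⟨4 * Real.exp 168, by positivity, 1, ?_⟩
  intro N hN x hx1 hx2
  have hN' : (1 : ℝ) ≤ N := by exact_mod_cast hN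
  have hs1 : 1 ≤ Real.sqrt N := Real.one_le_sqrt.2 hN'
  set s := Real.sqrt N with hs
  have hpi := Real.pi_pos
  set a : ℝ := Real.pi / (2 * s) with hadef
  have ha : 0 < a := by positivity
  obtain ⟨z, hz⟩ : ∃ z : ℂ, z = -(2 * Real.pi * Complex.I * mkTau x (1 / (4 * s))) := ⟨_, rfl⟩
  have hzq : Complex.exp (2 * Real.pi * Complex.I * mkTau x (1 / (4 * s))) = Complex.exp (-z) := by
    rw [hz, neg_neg]
  have hz' : z = ((a : ℝ) : ℂ) + ((-(2 * Real.pi * x) : ℝ) : ℂ) * Complex.I := by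
    rw [hz, mkTau, hadef]
    push_cast
    have hsc : (s : ℂ) ≠ 0 := by
      exact_mod_cast (by positivity : s ≠ 0)
    field_simp
    ring_nf
    rw [Complex.I_sq]
    ring
  have hzre : z.re = a := by rw [hz']; simp
  have hzim : |z.im| = 2 * Real.pi * |x| := by
    have : z.im = -(2 * Real.pi * x) := by rw [hz']; simp
    rw [this, abs_neg, abs_mul, abs_of_pos (by positivity)]
  rw [hzq]
  have hP := aux_P (z := z) (by rw [hzre]; exact ha)
    (by
      rw [hzre, hzim, hadef]
      calc Real.pi / (2 * s) = 2 * Real.pi * (1 / (4 * s)) := by field_simp; norm_num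
        _ ≤ _ := by gcongr)
    (by rw [hzim]; nlinarith)
  rw [hzre] at hP
  have hq : ‖Complex.exp (-z)‖ = Real.exp (-a) := by
    rw [Complex.norm_exp, Complex.neg_re, hzre]
  obtain ⟨hS1, hS2⟩ := aux_Sr ha hr hq
  have hexp : Real.pi ^ 2 / (8 * a) = Real.pi * s / 4 := by
    rw [hadef]; field_simp; norm_num
  rw [hexp] at hP
  have hmain : Real.sqrt a * (1 / a) ^ (r + 1) ≤ (N : ℝ) ^ ((r : ℝ) / 2 + 1 / 4) := by
    have e0 : Real.sqrt a * (1 / a) ^ (r + 1) = (1 / a) ^ ((r : ℝ) + 1 / 2) := by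
      rw [← Real.rpow_natCast, Real.sqrt_eq_rpow, one_div a, Real.inv_rpow ha.le, Real.inv_rpow ha.le,
        ← Real.rpow_neg ha.le, ← Real.rpow_neg ha.le, ← Real.rpow_add ha]
      congr 1
      push_cast
      ring
    have e1 : (N : ℝ) ^ ((r : ℝ) / 2 + 1 / 4) = s ^ ((r : ℝ) + 1 / 2) := by
      rw [hs, Real.sqrt_eq_rpow, ← Real.rpow_mul (by positivity)]
      congr 1
      ring
    rw [e0, e1]
    apply Real.rpow_le_rpow (by positivity) _ (by positivity)
    rw [hadef, one_div_div, div_le_iff₀ hpi]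
    nlinarith [Real.two_le_pi]
  have hprod : ∀ S : ℂ, ‖S‖ ≤ 2 * (1 / a) ^ (r + 1) →
      ‖poch (-Complex.exp (-z)) (Complex.exp (-z)) / poch (Complex.exp (-z)) (Complex.exp (-z))‖ * ‖S‖ ≤
      2 * Real.exp 168 * (N : ℝ) ^ ((r : ℝ) / 2 + 1 / 4) * Real.exp (Real.pi * s / 4) := by
    intro S hS
    calc _ ≤ (Real.exp 168 * Real.sqrt a * Real.exp (Real.pi * s / 4)) * (2 * (1 / a) ^ (r + 1)) := by
          gcongr
      _ = 2 * Real.exp 168 * (Real.sqrt a * (1 / a) ^ (r + 1)) * Real.exp (Real.pi * s / 4) := by ring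
      _ ≤ _ := by gcongr
  have hK : 0 ≤ Real.exp 168 * (N : ℝ) ^ ((r : ℝ) / 2 + 1 / 4) * Real.exp (Real.pi * s / 4) := by
    positivity
  constructor
  · rw [SCr, norm_mul]
    have := hprod _ hS1
    linarith
  · rw [SRr, norm_mul, norm_mul]
    have := hprod _ hS2
    have e2 : ‖(2 : ℂ)‖ = 2 := by simp
    rw [e2]
    linarith
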